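/- Let n be a positive integer. There exist constants K ≥ 1 and C ≥ 1 depending only on n such that for every 0 < ρ ≤ 1/2 the following holds. Let E be a unital ℝ-subalgebra of Mat_n(ℝ) that acts ρ-irreducibly on ℝⁿ. Then there is a real division algebra D ∈ {ℝ, ℂ, ℍ} and a positive integer m with m · dim_ℝ D = n such that E is isomorphic as an ℝ-algebra to Mat_m(D) via an algebra isomorphism φ : E → Mat_m(D) satisfying K^{-1} ρ^{C} ‖x‖ ≤ ‖φ(x)‖ ≤ K ρ^{-C} ‖x‖ for all x ∈ E, where Mat_n(ℝ) carries the operator norm (matrices acting on Euclidean ℝⁿ) and Mat_m(D) carries the operator norm of matrices acting ℝ-linearly on Dᵐ identified with Euclidean ℝⁿ. -/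

import Mathlib

/-- Operator norm of a square matrix over a normed ring `D`, acting (ℝ-linearly) by
matrix-vector multiplication on `Dᵐ` equipped with the `ℓ²`-norm (for `D = ℝ, ℂ, ℍ` this is
the Euclidean norm of `ℝⁿ`, `n = m · dim_ℝ D`). -/
noncomputable def matOpNorm {m : ℕ} {D : Type*} [NormedRing D]
    (M : Matrix (Fin m) (Fin m) D) : ℝ :=
  sSup ((fun v : PiLp 2 (fun _ : Fin m => D) =>
    ‖(WithLp.equiv 2 (Fin m → D)).symm (M.mulVec (WithLp.equiv 2 (Fin m → D) v))‖) ''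
    Metric.closedBall 0 1)

section Frobenius

variable {A : Type*} [Ring A] [IsDomain A] [Algebra ℝ A]

/-- In a real domain, an element whose square is real is real or a multiple of a square root
of `-1`. -/
theorem exists_sq_eq_neg_one_of_sq_eq_algebraMap {x : A} {e : ℝ} (h : x * x = algebraMap ℝ A e) :
    (∃ r : ℝ, x = algebraMap ℝ A r) ∨ (e < 0 ∧ ∃ s : ℝ, s ≠ 0 ∧ (s • x) * (s • x) = -1) := by
  rcases le_or_gt 0 e with he | he
  · left
    have hc := Algebra.commutes (√e) x
    have h0 : (x - algebraMap ℝ A √e) * (x + algebraMap ℝ A √e) = 0 := by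
      have : algebraMap ℝ A √e * algebraMap ℝ A √e = algebraMap ℝ A e := by
        rw [← map_mul, Real.mul_self_sqrt he]
      rw [sub_mul, mul_add, mul_add, h, this, hc]
      abel
    rcases mul_eq_zero.1 h0 with h1 | h1
    · exact ⟨√e, sub_eq_zero.1 h1⟩
    · exact ⟨-√e, by rw [map_neg]; exact eq_neg_of_add_eq_zero_left h1⟩
  · refine Or.inr ⟨he, (√(-e))⁻¹, ?_, ?_⟩
    · have : 0 < √(-e) := Real.sqrt_pos.2 (by linarith)
      positivity
    · rw [smul_mul_smul_comm, h, ← mul_inv, Real.mul_self_sqrt (by linarith),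
        Algebra.algebraMap_eq_smul_one, smul_smul, inv_neg, neg_mul, inv_mul_cancel₀ he.ne, neg_smul, one_smul]

/-- Every element of a finite-dimensional real domain is real or lies in a copy of `ℂ`. -/
theorem exists_eq_add_smul_sq_eq_neg_one [FiniteDimensional ℝ A] (x : A) :
    (∃ r : ℝ, x = algebraMap ℝ A r) ∨
      ∃ r s t : ℝ, s ≠ 0 ∧ (s • (x - algebraMap ℝ A r)) * (s • (x - algebraMap ℝ A r)) = -1 ∧
        x = algebraMap ℝ A r + t • (s • (x - algebraMap ℝ A r)) := by
  have hx : IsIntegral ℝ x := Algebra.IsIntegral.isIntegral x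
  have hdeg := (minpoly.irreducible hx).natDegree_le_two
  set p := minpoly ℝ x with hp
  have hpm : p.Monic := minpoly.monic hx
  have hp0 : Polynomial.aeval x p = 0 := minpoly.aeval ℝ x
  have hpos : 0 < p.natDegree := minpoly.natDegree_pos hx
  rw [Polynomial.aeval_eq_sum_range] at hp0
  have hcoeff : p.coeff p.natDegree = 1 := hpm
  obtain h1 | h2 : p.natDegree = 1 ∨ p.natDegree = 2 := by omega
  · rw [h1] at hp0 hcoeff
    simp only [Finset.sum_range_succ, Finset.sum_range_zero, hcoeff] at hp0
    refine Or.inl ⟨-p.coeff 0, ?_⟩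
    rw [map_neg, Algebra.algebraMap_eq_smul_one]
    simp only [pow_zero, zero_add, pow_one, one_smul] at hp0
    exact eq_neg_of_add_eq_zero_right hp0
  · rw [h2] at hp0 hcoeff
    simp only [Finset.sum_range_succ, Finset.sum_range_zero, hcoeff] at hp0
    simp only [pow_zero, zero_add, pow_one, one_smul] at hp0
    set b := p.coeff 1
    set c := p.coeff 0
    have key : (x - algebraMap ℝ A (-(b / 2))) * (x - algebraMap ℝ A (-(b / 2))) =
        algebraMap ℝ A (b ^ 2 / 4 - c) := by
      have h3 : x ^ 2 = -(c • (1 : A) + b • x) := eq_neg_of_add_eq_zero_right hp0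
      have h4 : (x - algebraMap ℝ A (-(b / 2))) * (x - algebraMap ℝ A (-(b / 2))) =
          x ^ 2 + b • x + (b ^ 2 / 4) • (1 : A) := by
        simp only [Algebra.algebraMap_eq_smul_one, sub_mul, mul_sub, mul_smul_comm, smul_mul_assoc,
          mul_one, one_mul, pow_two]
        module
      rw [h4, h3, Algebra.algebraMap_eq_smul_one]
      module
    rcases exists_sq_eq_neg_one_of_sq_eq_algebraMap key with ⟨r, hr⟩ | ⟨-, s, hs, h⟩
    · exact Or.inl ⟨r + -(b / 2), by rw [map_add, ← hr]; abel⟩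
    · refine Or.inr ⟨-(b / 2), s, s⁻¹, hs, h, ?_⟩
      rw [smul_smul, inv_mul_cancel₀ hs, one_smul]
      abel

/-- The centralizer of a square root `I` of `-1` in a finite-dimensional real domain
is `ℝ + ℝ I`. -/
theorem exists_eq_add_smul_of_commute [FiniteDimensional ℝ A] {I x : A} (hI : I * I = -1)
    (hx : x * I = I * x) : ∃ r t : ℝ, x = algebraMap ℝ A r + t • I := by
  rcases exists_eq_add_smul_sq_eq_neg_one x with ⟨r, hr⟩ | ⟨r, s, t, -, hJ, hxJ⟩
  · exact ⟨r, 0, by simpa using hr⟩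
  · set J := s • (x - algebraMap ℝ A r) with hJdef
    have hc : J * I = I * J := by
      simp only [hJdef, smul_mul_assoc, mul_smul_comm, sub_mul, mul_sub, hx, Algebra.commutes]
    have h0 : (J - I) * (J + I) = 0 := by
      rw [sub_mul, mul_add, mul_add, hJ, hI, hc]; abel
    rcases mul_eq_zero.1 h0 with h1 | h1
    · exact ⟨r, t, by rw [← sub_eq_zero.1 h1]; exact hxJ⟩
    · refine ⟨r, -t, ?_⟩
      rw [eq_neg_of_add_eq_zero_left h1] at hxJ
      rw [neg_smul, ← smul_neg]
      exact hxJ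

/-- **Frobenius' theorem**: a finite-dimensional real domain is a quotient of `ℝ`, `ℂ` or `ℍ`. -/
theorem frobenius_surjective [FiniteDimensional ℝ A] :
    Function.Surjective (algebraMap ℝ A) ∨
      (∃ f : ℂ →ₐ[ℝ] A, Function.Surjective f) ∨
      ∃ f : Quaternion ℝ →ₐ[ℝ] A, Function.Surjective f := by
  by_cases h1 : Function.Surjective (algebraMap ℝ A)
  · exact Or.inl h1
  right
  obtain ⟨I, hI⟩ : ∃ I : A, I * I = -1 := by
    simp only [Function.Surjective, not_forall, not_exists] at h1
    obtain ⟨x, hx⟩ := h1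
    rcases exists_eq_add_smul_sq_eq_neg_one x with ⟨r, hr⟩ | ⟨r, s, t, -, hJ, -⟩
    · exact absurd hr.symm (hx r)
    · exact ⟨_, hJ⟩
  by_cases h2 : ∀ x : A, x * I = I * x
  · refine Or.inl ⟨Complex.lift ⟨I, hI⟩, fun x => ?_⟩
    obtain ⟨r, t, rfl⟩ := exists_eq_add_smul_of_commute hI (h2 x)
    exact ⟨⟨r, t⟩, by simp⟩
  right
  push Not at h2
  obtain ⟨T, hT⟩ := h2
  have hI' : ∀ y : A, I * (I * y) = -y := fun y => by rw [← mul_assoc, hI, neg_one_mul]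
  obtain ⟨J, hJ, hJI⟩ : ∃ J : A, J * J = -1 ∧ J * I = -(I * J) := by
    obtain ⟨S, hS⟩ : ∃ S, S = T + I * T * I := ⟨_, rfl⟩
    have hSI : S * I = -(I * S) := by
      simp only [hS, add_mul, mul_add, mul_assoc, hI, hI']
      simp
    have hS0 : S ≠ 0 := by
      intro h
      apply hT
      have : I * S = 0 := by rw [h, mul_zero]
      simp only [hS, mul_add, mul_assoc, hI'] at this
      rw [← sub_eq_add_neg, sub_eq_zero] at this
      exact this.symm
    have hI0 : I ≠ 0 := by
      rintro rfl
      simp at hI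
    have hIS0 : I * S ≠ 0 := mul_ne_zero hI0 hS0
    have two : ∀ y : A, y = -y → y = 0 := fun y hy => by
      have h : (2 : ℝ) • y = 0 := by
        rw [two_smul]; nth_rewrite 2 [hy]; abel
      exact (smul_eq_zero.1 h).resolve_left two_ne_zero
    obtain ⟨a, b, hab⟩ := exists_eq_add_smul_of_commute (x := S * S) hI (by
      rw [mul_assoc, hSI, mul_neg, ← mul_assoc, hSI]; simp [mul_assoc])
    have hb : b = 0 := by
      have h3 : S * (S * S) = (S * S) * S := (mul_assoc _ _ _).symm
      rw [hab, mul_add, add_mul, ← Algebra.commutes a S, add_right_inj, mul_smul_comm, smul_mul_assoc,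
        hSI] at h3
      by_contra hb
      have h4 := smul_right_injective A hb h3
      exact hIS0 (two _ h4.symm)
    rw [hb, zero_smul, add_zero] at hab
    rcases exists_sq_eq_neg_one_of_sq_eq_algebraMap hab with ⟨r, hr⟩ | ⟨-, s, -, hs⟩
    · rw [hr, Algebra.commutes] at hSI
      exact absurd (two _ (hr ▸ hSI)) (hr ▸ hIS0)
    · exact ⟨s • S, hs, by rw [smul_mul_assoc, hSI, mul_smul_comm, smul_neg]⟩
  let Q : QuaternionAlgebra.Basis A (-1 : ℝ) 0 (-1) :=
    { i := I, j := J, k := I * J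
      i_mul_i := by simp [hI]
      j_mul_j := by simp [hJ]
      i_mul_j := rfl
      j_mul_i := by simp [hJI] }
  refine ⟨Q.liftHom, fun x => ?_⟩
  obtain ⟨a, b, h3⟩ := exists_eq_add_smul_of_commute (x := x - I * x * I) hI (by
    simp only [sub_mul, mul_sub, mul_assoc, hI, hI']; simp; abel)
  obtain ⟨c, d, h4⟩ := exists_eq_add_smul_of_commute (x := (x + I * x * I) * J) hI (by
    simp only [add_mul, mul_add, mul_assoc, hJI, hI', mul_neg]; simp [← mul_assoc]
    abel)
  have h5 : x + I * x * I = -((algebraMap ℝ A c + d • I) * J) := by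
    rw [← h4, mul_assoc _ J J, hJ, mul_neg_one, neg_neg]
  have h6 : (2 : ℝ) • x = algebraMap ℝ A a + b • I - (algebraMap ℝ A c + d • I) * J := by
    rw [sub_eq_add_neg, ← h3, ← h5]; module
  refine ⟨⟨a / 2, b / 2, -c / 2, -d / 2⟩, smul_right_injective A (two_ne_zero (α := ℝ)) ?_⟩
  simp only [h6]
  change (2 : ℝ) • Q.lift _ = _
  simp only [QuaternionAlgebra.Basis.lift, Q, Algebra.algebraMap_eq_smul_one, add_mul,
    smul_mul_assoc, one_mul]
  module

end Frobenius

section Commutant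

open Module LinearMap

variable {n : ℕ}

/-- `ρ`-irreducibility of a subalgebra of endomorphisms of Euclidean space. -/
def ActsIrreducibly (ρ : ℝ)
    (E : Subalgebra ℝ (EuclideanSpace ℝ (Fin n) →L[ℝ] EuclideanSpace ℝ (Fin n))) : Prop :=
  ∀ W : Submodule ℝ (EuclideanSpace ℝ (Fin n)), W ≠ ⊥ → W ≠ ⊤ →
    ∃ a ∈ E, ‖a‖ ≤ 1 ∧ ∃ w ∈ W, ‖w‖ ≤ 1 ∧
      ρ ≤ Metric.infDist (a w) (W : Set (EuclideanSpace ℝ (Fin n)))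

theorem sq_norm_apply_eq_sum_eigenvalues {V : Type*} [NormedAddCommGroup V] [InnerProductSpace ℝ V]
    [FiniteDimensional ℝ V] (hV : finrank ℝ V = n) (T : V →ₗ[ℝ] V) (v : V) :
    ‖T v‖ ^ 2 = ∑ i, T.isSymmetric_adjoint_comp_self.eigenvalues hV i *
      ((T.isSymmetric_adjoint_comp_self.eigenvectorBasis hV).repr v i) ^ 2 := by
  set hS := T.isSymmetric_adjoint_comp_self
  rw [← real_inner_self_eq_norm_sq, ← LinearMap.adjoint_inner_right,
    ← (hS.eigenvectorBasis hV).repr.inner_map_map, PiLp.inner_apply]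
  refine Finset.sum_congr rfl fun i _ => ?_
  have := hS.eigenvectorBasis_apply_self_apply hV v i
  rw [LinearMap.comp_apply] at this
  rw [this]
  simp
  ring

theorem ActsIrreducibly.sq_mul_eigenvalue_le {ρ : ℝ} (hρ : 0 < ρ)
    {E : Subalgebra ℝ (EuclideanSpace ℝ (Fin n) →L[ℝ] EuclideanSpace ℝ (Fin n))}
    (hE : ActsIrreducibly ρ E)
    {T : EuclideanSpace ℝ (Fin n) →ₗ[ℝ] EuclideanSpace ℝ (Fin n)}
    (hT : ∀ a ∈ E, ∀ v, T (a v) = a (T v))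
    (hV : finrank ℝ (EuclideanSpace ℝ (Fin n)) = n) {j k : Fin n} (hjk : (j : ℕ) + 1 = k) :
    ρ ^ 2 * T.isSymmetric_adjoint_comp_self.eigenvalues hV j ≤
      T.isSymmetric_adjoint_comp_self.eigenvalues hV k := by
  set l := T.isSymmetric_adjoint_comp_self.eigenvalues hV
  set b := T.isSymmetric_adjoint_comp_self.eigenvectorBasis hV
  have hanti : Antitone l := T.isSymmetric_adjoint_comp_self.eigenvalues_antitone hV
  have hnn : ∀ i, 0 ≤ l i := fun i => T.isPositive_adjoint_comp_self.nonneg_eigenvalues hV i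
  have hsum : ∀ v, ‖T v‖ ^ 2 = ∑ i, l i * (b.repr v i) ^ 2 :=
    sq_norm_apply_eq_sum_eigenvalues hV T
  have hnorm : ∀ v, ‖v‖ ^ 2 = ∑ i, (b.repr v i) ^ 2 := fun v => by
    rw [← b.repr.norm_map, EuclideanSpace.norm_sq_eq]
    simp
  let U : Submodule ℝ (EuclideanSpace ℝ (Fin n)) :=
    { carrier := {v | ∀ i, i ≤ j → b.repr v i = 0}
      zero_mem' := by simp
      add_mem' := fun {x y} hx hy i hi => by simp [hx i hi, hy i hi]
      smul_mem' := fun c x hx i hi => by simp [hx i hi] }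
  have hkU : b k ∈ U := fun i hi => by
    have : i ≠ k := by
      rintro rfl
      rw [Fin.le_def] at hi
      omega
    simp [this]
  have hjU : b j ∉ U := fun h => by simpa using h j le_rfl
  obtain ⟨a, haE, ha1, u, huU, hu1, hd⟩ := hE U
    (fun h => b.toBasis.ne_zero k (by simpa [h] using hkU)) (fun h => hjU (h ▸ trivial))
  have hTu : ‖T u‖ ^ 2 ≤ l k := by
    rw [hsum]
    calc _ ≤ ∑ i, l k * (b.repr u i) ^ 2 := by
          refine Finset.sum_le_sum fun i _ => ?_
          by_cases hi : i ≤ j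
          · simp [huU i hi]
          · refine mul_le_mul_of_nonneg_right (hanti ?_) (sq_nonneg _)
            rw [Fin.le_def] at hi ⊢
            omega
      _ = l k * ‖u‖ ^ 2 := by rw [hnorm, Finset.mul_sum]
      _ ≤ l k * 1 := mul_le_mul_of_nonneg_left (pow_le_one₀ (norm_nonneg _) hu1) (hnn k)
      _ = l k := mul_one _
  have haTu : ‖T (a u)‖ ^ 2 ≤ l k := by
    rw [hT a haE]
    refine le_trans (pow_le_pow_left₀ (norm_nonneg _) ?_ 2) hTu
    simpa using a.le_of_opNorm_le ha1 (T u)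
  have hlow : l j * ρ ^ 2 ≤ ‖T (a u)‖ ^ 2 := by
    set p : EuclideanSpace ℝ (Fin n) :=
      b.repr.symm (WithLp.toLp 2 fun i => if i ≤ j then 0 else b.repr (a u) i) with hp
    have hpU : p ∈ U := fun i hi => by simp [hp, hi]
    have h1 : ρ ≤ ‖a u - p‖ := by
      rw [← dist_eq_norm]
      exact hd.trans (Metric.infDist_le_dist_of_mem hpU)
    have h2 : ρ ^ 2 ≤ ‖a u - p‖ ^ 2 := pow_le_pow_left₀ hρ.le h1 2
    refine (mul_le_mul_of_nonneg_left h2 (hnn j)).trans ?_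
    rw [hnorm, hsum, Finset.mul_sum]
    refine Finset.sum_le_sum fun i _ => ?_
    by_cases hi : i ≤ j
    · have : b.repr (a u - p) i = b.repr (a u) i := by simp [hp, hi]
      rw [this]
      exact mul_le_mul_of_nonneg_right (hanti hi) (sq_nonneg _)
    · have : b.repr (a u - p) i = 0 := by simp [hp, hi]
      rw [this]
      simpa using mul_nonneg (hnn i) (sq_nonneg _)
  linarith

/-- Elements of the commutant of a `ρ`-irreducible algebra are well conditioned. -/
theorem ActsIrreducibly.pow_mul_norm_apply_le {ρ : ℝ} (hρ : 0 < ρ) (hρ1 : ρ ≤ 1)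
    {E : Subalgebra ℝ (EuclideanSpace ℝ (Fin n) →L[ℝ] EuclideanSpace ℝ (Fin n))}
    (hE : ActsIrreducibly ρ E)
    {T : EuclideanSpace ℝ (Fin n) →ₗ[ℝ] EuclideanSpace ℝ (Fin n)}
    (hT : ∀ a ∈ E, ∀ v, T (a v) = a (T v)) (v w : EuclideanSpace ℝ (Fin n)) :
    ρ ^ n * (‖T v‖ * ‖w‖) ≤ ‖T w‖ * ‖v‖ := by
  have hV : finrank ℝ (EuclideanSpace ℝ (Fin n)) = n := by simp
  set l := T.isSymmetric_adjoint_comp_self.eigenvalues hV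
  set b := T.isSymmetric_adjoint_comp_self.eigenvectorBasis hV
  have hnn : ∀ i, 0 ≤ l i := fun i => T.isPositive_adjoint_comp_self.nonneg_eigenvalues hV i
  have hanti : Antitone l := T.isSymmetric_adjoint_comp_self.eigenvalues_antitone hV
  have hsum : ∀ v, ‖T v‖ ^ 2 = ∑ i, l i * (b.repr v i) ^ 2 :=
    sq_norm_apply_eq_sum_eigenvalues hV T
  have hnorm : ∀ v, ‖v‖ ^ 2 = ∑ i, (b.repr v i) ^ 2 := fun v => by
    rw [← b.repr.norm_map, EuclideanSpace.norm_sq_eq]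
    simp
  have hstep : ∀ (d : ℕ) (j k : Fin n), (j : ℕ) + d = k → (ρ ^ 2) ^ d * l j ≤ l k := by
    intro d
    induction d with
    | zero =>
      intro j k h
      obtain rfl : j = k := Fin.ext (by simpa using h)
      simp
    | succ d ih =>
      intro j k h
      have hd : (j : ℕ) + d < n := by omega
      have h1 := ih j ⟨_, hd⟩ rfl
      have h2 := hE.sq_mul_eigenvalue_le hρ hT hV (j := ⟨_, hd⟩) (k := k) (by simp; omega)
      rw [pow_succ', mul_assoc]
      exact (mul_le_mul_of_nonneg_left h1 (sq_nonneg ρ)).trans h2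
  have hall : ∀ j k : Fin n, (ρ ^ n) ^ 2 * l j ≤ l k := by
    intro j k
    have hle : (ρ ^ n) ^ 2 ≤ 1 := pow_le_one₀ (by positivity) (pow_le_one₀ hρ.le hρ1)
    rcases le_total j k with hjk | hjk
    · obtain ⟨d, hd⟩ := Nat.exists_eq_add_of_le (Fin.le_def.1 hjk)
      refine le_trans (mul_le_mul_of_nonneg_right ?_ (hnn j)) (hstep d j k hd.symm)
      rw [← pow_mul, mul_comm n 2, pow_mul]
      exact pow_le_pow_of_le_one (by positivity) (pow_le_one₀ hρ.le hρ1) (by omega)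
    · exact (mul_le_of_le_one_left (hnn j) hle).trans (hanti hjk)
  rw [← sq_le_sq₀ (by positivity) (by positivity)]
  simp only [mul_pow]
  rw [hsum v, hsum w, hnorm v, hnorm w, Finset.sum_mul_sum, Finset.sum_mul_sum, Finset.mul_sum,
    Finset.sum_comm]
  simp only [Finset.mul_sum]
  refine Finset.sum_le_sum fun k _ => Finset.sum_le_sum fun i _ => ?_
  have := mul_le_mul_of_nonneg_right (hall k i)
    (mul_nonneg (sq_nonneg (b.repr v k)) (sq_nonneg (b.repr w i)))
  linarith

theorem ActsIrreducibly.eq_bot_or_eq_top {ρ : ℝ} (hρ : 0 < ρ)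
    {E : Subalgebra ℝ (EuclideanSpace ℝ (Fin n) →L[ℝ] EuclideanSpace ℝ (Fin n))}
    (hE : ActsIrreducibly ρ E) (W : Submodule ℝ (EuclideanSpace ℝ (Fin n)))
    (hW : ∀ a ∈ E, ∀ w ∈ W, a w ∈ W) : W = ⊥ ∨ W = ⊤ := by
  by_contra! h
  obtain ⟨a, haE, -, w, hw, -, hd⟩ := hE W h.1 h.2
  rw [Metric.infDist_zero_of_mem (hW a haE w hw)] at hd
  linarith

variable {V : Type*} [NormedAddCommGroup V] [NormedSpace ℝ V] [Nontrivial V]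
  {E : Subalgebra ℝ (V →L[ℝ] V)}

/-- Schur's lemma for an irreducible algebra of operators. -/
theorem isDomain_centralizer_of_irreducible
    (hE : ∀ W : Submodule ℝ V, (∀ a ∈ E, ∀ w ∈ W, a w ∈ W) → W = ⊥ ∨ W = ⊤) :
    IsDomain (Subalgebra.centralizer ℝ (E : Set (V →L[ℝ] V))) := by
  have : NoZeroDivisors (Subalgebra.centralizer ℝ (E : Set (V →L[ℝ] V))) := by
    refine ⟨fun {S T} hST => ?_⟩
    have hS := (Subalgebra.mem_centralizer_iff ℝ).1 S.2
    rcases hE (LinearMap.ker (S : V →L[ℝ] V).toLinearMap)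
      (fun a ha w hw => by
        have h1 : a (S.1 w) = S.1 (a w) := DFunLike.congr_fun (hS a ha) w
        have h2 : S.1 w = 0 := hw
        change S.1 (a w) = 0
        rw [← h1, h2, map_zero]) with h | h
    · right
      ext v
      have h1 : S.1 (T.1 v) = 0 := DFunLike.congr_fun (congrArg Subtype.val hST) v
      exact LinearMap.ker_eq_bot'.1 h _ h1
    · left
      ext v
      exact LinearMap.congr_fun (LinearMap.ker_eq_top.1 h) v
  exact NoZeroDivisors.to_isDomain _

/-- The double commutant theorem for an irreducible algebra of operators. -/
theorem mem_of_irreducible_of_commute [FiniteDimensional ℝ V]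
    (hE : ∀ W : Submodule ℝ V, (∀ a ∈ E, ∀ w ∈ W, a w ∈ W) → W = ⊥ ∨ W = ⊤) {x : V →L[ℝ] V}
    (hx : ∀ T ∈ Subalgebra.centralizer ℝ (E : Set (V →L[ℝ] V)), x * T = T * x) : x ∈ E := by
  have : IsScalarTower ℝ E V := ⟨fun r a v => rfl⟩
  have : IsSimpleModule E V :=
    { exists_pair_ne := ⟨⊥, ⊤, bot_ne_top⟩
      eq_bot_or_eq_top := fun W => by
        have := hE (W.restrictScalars ℝ) (fun a ha w hw => W.smul_mem (⟨a, ha⟩ : E) hw)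
        simpa using this }
  let f : Module.End (Module.End E V) V :=
    { toFun := x
      map_add' := map_add x
      map_smul' := fun g v => by
        have hg : LinearMap.toContinuousLinearMap (g.restrictScalars ℝ) ∈
            Subalgebra.centralizer ℝ (E : Set (V →L[ℝ] V)) := by
          rw [Subalgebra.mem_centralizer_iff]
          intro a ha
          ext1 v
          exact (g.map_smul (⟨a, ha⟩ : E) v).symm
        exact DFunLike.congr_fun (hx _ hg) v }
  obtain ⟨s, hs⟩ := Module.Finite.fg_top (R := ℝ) (M := V)
  obtain ⟨r, hr⟩ := jacobson_density (R := E) f s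
  have : x = r.1 := by
    refine ContinuousLinearMap.coe_injective (LinearMap.ext_on hs ?_)
    intro v hv
    exact hr v hv
  rw [this]
  exact r.2

end Commutant

section MatOpNorm

variable {m : ℕ} {D : Type*} [NormedRing D]

theorem norm_toLp_le_card_mul {m : ℕ} (q : Fin m → D) {c : ℝ} (hc : ∀ l, ‖q l‖ ≤ c) :
    ‖WithLp.toLp 2 q‖ ≤ m * c := by
  rcases Nat.eq_zero_or_pos m with rfl | hm
  · simp [Subsingleton.elim (WithLp.toLp 2 q) 0]
  have hc0 : 0 ≤ c := (norm_nonneg _).trans (hc ⟨0, hm⟩)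
  refine le_of_sq_le_sq ?_ (by positivity)
  rw [PiLp.norm_sq_eq_of_L2]
  calc ∑ l, ‖q l‖ ^ 2 ≤ ∑ _l : Fin m, c ^ 2 :=
        Finset.sum_le_sum fun l _ => pow_le_pow_left₀ (norm_nonneg _) (hc l) 2
    _ = m * c ^ 2 := by simp
    _ ≤ (m * c) ^ 2 := by
      rw [mul_pow]
      refine mul_le_mul_of_nonneg_right ?_ (sq_nonneg c)
      exact_mod_cast Nat.le_self_pow two_ne_zero m

theorem matOpNorm_le {M : Matrix (Fin m) (Fin m) D} {c : ℝ} (hc : 0 ≤ c)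
    (h : ∀ q : Fin m → D, ‖WithLp.toLp 2 (M.mulVec q)‖ ≤ c * ‖WithLp.toLp 2 q‖) :
    matOpNorm M ≤ c := by
  refine Real.sSup_le ?_ hc
  rintro _ ⟨v, hv, rfl⟩
  refine (h v.ofLp).trans (mul_le_of_le_one_right hc ?_)
  simpa using hv

theorem le_matOpNorm [NormedAlgebra ℝ D] {M : Matrix (Fin m) (Fin m) D} {c : ℝ} (hc : 0 ≤ c)
    (h : ∀ q : Fin m → D, ‖WithLp.toLp 2 (M.mulVec q)‖ ≤ c * ‖WithLp.toLp 2 q‖)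
    (q : Fin m → D) :
    ‖WithLp.toLp 2 (M.mulVec q)‖ ≤ matOpNorm M * ‖WithLp.toLp 2 q‖ := by
  by_cases hq : ‖WithLp.toLp 2 q‖ = 0
  · have := h q
    rwa [hq, mul_zero] at this ⊢
  have hb : BddAbove ((fun v : PiLp 2 (fun _ : Fin m => D) =>
      ‖(WithLp.equiv 2 (Fin m → D)).symm (M.mulVec (WithLp.equiv 2 (Fin m → D) v))‖) ''
      Metric.closedBall 0 1) := by
    refine ⟨c, ?_⟩
    rintro _ ⟨v, hv, rfl⟩
    refine (h v.ofLp).trans (mul_le_of_le_one_right hc ?_)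
    simpa using hv
  have hpos : 0 < ‖WithLp.toLp 2 q‖ := lt_of_le_of_ne (norm_nonneg _) (Ne.symm hq)
  have := le_csSup hb ⟨‖WithLp.toLp 2 q‖⁻¹ • WithLp.toLp 2 q, by
    simp only [Metric.mem_closedBall, dist_zero_right]
    rw [norm_smul, norm_inv, norm_norm, inv_mul_cancel₀ hq], rfl⟩
  change ‖WithLp.toLp 2 (M.mulVec (‖WithLp.toLp 2 q‖⁻¹ • q))‖ ≤ matOpNorm M at this
  rw [Matrix.mulVec_smul, WithLp.toLp_smul, norm_smul, norm_inv, norm_norm] at this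
  rwa [inv_mul_le_iff₀ hpos, mul_comm] at this

end MatOpNorm

section RightAction

open MulOpposite Module

variable {D : Type*} [NormedDivisionRing D] [NormedAlgebra ℝ D]
  {V : Type*} [NormedAddCommGroup V] [InnerProductSpace ℝ V]

/-- The map `q ↦ ∑ v_l q_l` for a right action of `D` on `V`. -/
def rightCombination (R : D →ₐ[ℝ] (V →L[ℝ] V)ᵐᵒᵖ) {m : ℕ} (v : Fin m → V) :
    (Fin m → D) →ₗ[ℝ] V where
  toFun q := ∑ l, (R (q l)).unop (v l)
  map_add' p q := by simp [Finset.sum_add_distrib]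
  map_smul' c q := by simp [Finset.smul_sum]

variable {R : D →ₐ[ℝ] (V →L[ℝ] V)ᵐᵒᵖ} {B : ℝ}

theorem rightCombination_apply {m : ℕ} (v : Fin m → V) (q : Fin m → D) :
    rightCombination R v q = ∑ l, (R (q l)).unop (v l) := rfl

theorem unop_rightCombination {m : ℕ} (v : Fin m → V) (q : Fin m → D) (d : D) :
    (R d).unop (rightCombination R v q) = rightCombination R v (fun l => q l * d) := by
  simp [rightCombination_apply]

/-- A family of unit vectors that is quantitatively independent for a right action of `D`. -/
def IsQuantIndep (R : D →ₐ[ℝ] (V →L[ℝ] V)ᵐᵒᵖ) (B : ℝ) {m : ℕ} (v : Fin m → V) : Prop :=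
  (∀ l, ‖v l‖ = 1) ∧ ∀ (q : Fin m → D) (l : Fin m),
    ‖q l‖ ≤ B * (1 + B ^ 2) ^ m * ‖rightCombination R v q‖

theorem IsQuantIndep.snoc [FiniteDimensional ℝ V] (hB0 : 0 ≤ B)
    (hB : ∀ d v, ‖(R d).unop v‖ ≤ B * ‖d‖ * ‖v‖) {m : ℕ} {v : Fin m → V}
    (hv : IsQuantIndep R B v) (hs : ¬ Function.Surjective (rightCombination R v)) :
    ∃ w : V, IsQuantIndep R B (Fin.snoc v w : Fin (m + 1) → V) := by
  set W := LinearMap.range (rightCombination R v) with hW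
  have hWt : W ≠ ⊤ := fun h => hs (LinearMap.range_eq_top.1 h)
  obtain ⟨w₀, hw₀, hw₀0⟩ := Submodule.exists_mem_ne_zero_of_ne_bot
    (mt (Submodule.orthogonal_eq_bot_iff (K := W)).1 hWt)
  have hn0 : ‖w₀‖ ≠ 0 := norm_ne_zero_iff.2 hw₀0
  set w := ‖w₀‖⁻¹ • w₀ with hw
  have hwW : w ∈ Wᗮ := Submodule.smul_mem _ _ hw₀
  have hw1 : ‖w‖ = 1 := by rw [hw, norm_smul, norm_inv, norm_norm, inv_mul_cancel₀ hn0]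
  refine ⟨w, fun l => ?_, fun q l => ?_⟩
  · induction l using Fin.lastCases with
    | last => simpa using hw1
    | cast l => simpa using hv.1 l
  have hsplit : rightCombination R (Fin.snoc v w : Fin (m + 1) → V) q =
      rightCombination R v (fun l => q l.castSucc) + (R (q (Fin.last m))).unop w := by
    simp [rightCombination_apply, Fin.sum_univ_castSucc]
  rw [hsplit]
  set x := rightCombination R v (fun l => q l.castSucc) with hx
  set d := q (Fin.last m) with hd
  have hlast : ‖d‖ ≤ B * ‖x + (R d).unop w‖ := by
    by_cases hd0 : d = 0
    · rw [hd0, norm_zero]; positivity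
    have h1 : (R d⁻¹).unop (x + (R d).unop w) = (R d⁻¹).unop x + w := by
      rw [map_add, ← mul_apply_eq_comp, ← unop_mul, ← map_mul, mul_inv_cancel₀ hd0]
      simp
    have h2 : inner ℝ ((R d⁻¹).unop x) w = 0 := by
      refine Submodule.inner_right_of_mem_orthogonal (K := W) ?_ hwW
      rw [hx, unop_rightCombination]
      exact LinearMap.mem_range_self _ _
    have h3 : 1 ≤ ‖(R d⁻¹).unop x + w‖ := by
      have := norm_add_sq_eq_norm_sq_add_norm_sq_real h2
      rw [hw1] at this
      nlinarith [norm_nonneg ((R d⁻¹).unop x + w), mul_self_nonneg ‖(R d⁻¹).unop x‖]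
    have h4 := h3.trans (h1 ▸ hB d⁻¹ (x + (R d).unop w))
    have hdpos : 0 < ‖d‖ := norm_pos_iff.2 hd0
    rw [norm_inv, mul_comm B, mul_assoc, ← div_eq_inv_mul, le_div_iff₀ hdpos, one_mul] at h4
    exact h4
  have hge : 1 ≤ 1 + B ^ 2 := by nlinarith
  induction l using Fin.lastCases with
  | last =>
    refine hlast.trans (mul_le_mul_of_nonneg_right ?_ (norm_nonneg _))
    exact le_mul_of_one_le_right hB0 (one_le_pow₀ hge)
  | cast l =>
    refine (hv.2 (fun l => q l.castSucc) l).trans ?_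
    rw [← hx, pow_succ (1 + B ^ 2) m, ← mul_assoc B, mul_assoc (B * _) (1 + B ^ 2)]
    refine mul_le_mul_of_nonneg_left ?_ (by positivity)
    have h5 : ‖x‖ ≤ ‖x + (R d).unop w‖ + ‖(R d).unop w‖ := by
      simpa using norm_sub_le (x + (R d).unop w) ((R d).unop w)
    have h6 := hB d w
    rw [hw1, mul_one] at h6
    nlinarith [mul_le_mul_of_nonneg_left hlast hB0]

theorem IsQuantIndep.injective {m : ℕ} {v : Fin m → V} (hv : IsQuantIndep R B v) :
    Function.Injective (rightCombination R v) := by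
  refine (injective_iff_map_eq_zero _).2 fun q hq => funext fun l => ?_
  have := hv.2 q l
  rw [hq, norm_zero, mul_zero] at this
  simpa using this

theorem exists_isQuantIndep_bijective [FiniteDimensional ℝ V] [FiniteDimensional ℝ D] (hB0 : 0 ≤ B)
    (hB : ∀ d v, ‖(R d).unop v‖ ≤ B * ‖d‖ * ‖v‖) :
    ∃ (m : ℕ) (v : Fin m → V), IsQuantIndep R B v ∧
      Function.Bijective (rightCombination R v) := by
  by_contra! hcon
  have hall : ∀ m : ℕ, ∃ v : Fin m → V, IsQuantIndep R B v := by
    intro m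
    induction m with
    | zero => exact ⟨Fin.elim0, fun l => l.elim0, fun _ l => l.elim0⟩
    | succ m ih =>
      obtain ⟨v, hv⟩ := ih
      obtain ⟨w, hw⟩ := hv.snoc hB0 hB (fun h => hcon m v hv ⟨hv.injective, h⟩)
      exact ⟨_, hw⟩
  obtain ⟨v, hv⟩ := hall (finrank ℝ V + 1)
  have := LinearMap.finrank_le_finrank_of_injective hv.injective
  rw [Module.finrank_pi_fintype] at this
  simp only [Finset.sum_const, Finset.card_univ, Fintype.card_fin, smul_eq_mul] at this
  nlinarith [Module.finrank_pos (R := ℝ) (M := D)]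

theorem norm_rightCombination_le {m : ℕ} {v : Fin m → V} (hv : IsQuantIndep R B v) (hB0 : 0 ≤ B)
    (hB : ∀ d v, ‖(R d).unop v‖ ≤ B * ‖d‖ * ‖v‖) (q : Fin m → D) :
    ‖rightCombination R v q‖ ≤ m * B * ‖WithLp.toLp 2 q‖ := by
  calc ‖rightCombination R v q‖ ≤ ∑ _l : Fin m, B * ‖WithLp.toLp 2 q‖ := by
        rw [rightCombination_apply]
        refine norm_sum_le_of_le _ fun l _ => (hB _ _).trans ?_
        rw [hv.1 l, mul_one]
        exact mul_le_mul_of_nonneg_left (PiLp.norm_apply_le (WithLp.toLp 2 q) l) hB0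
    _ = m * B * ‖WithLp.toLp 2 q‖ := by simp [mul_assoc]

/-- The commutant of a right action of `D` is identified with a matrix algebra by a basis. -/
theorem exists_matrix_algEquiv_of_bijective [FiniteDimensional ℝ V] {m : ℕ} {v : Fin m → V}
    (hv : Function.Bijective (rightCombination R v)) {E : Subalgebra ℝ (V →L[ℝ] V)}
    (hE : ∀ x, x ∈ E ↔ ∀ d v, x ((R d).unop v) = (R d).unop (x v)) :
    ∃ φ : E ≃ₐ[ℝ] Matrix (Fin m) (Fin m) D, ∀ (x : E) (q : Fin m → D),
      rightCombination R v ((φ x).mulVec q) = x.1 (rightCombination R v q) := by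
  set S := LinearEquiv.ofBijective _ hv
  have hSR : ∀ q d, (R d).unop (S q) = S (fun l => q l * d) := unop_rightCombination v
  have hmul : ∀ (M : Matrix (Fin m) (Fin m) D) (q : Fin m → D) (d : D),
      M.mulVec (fun l => q l * d) = fun k => M.mulVec q k * d := by
    intro M q d
    ext k
    simp [Matrix.mulVec, dotProduct, Finset.sum_mul, mul_assoc]
  let T : Matrix (Fin m) (Fin m) D → (V →L[ℝ] V) := fun M => LinearMap.toContinuousLinearMap
    { toFun := fun x => S (M.mulVec (S.symm x))
      map_add' := fun x y => by rw [map_add, Matrix.mulVec_add, map_add]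
      map_smul' := fun c x => by rw [map_smul, Matrix.mulVec_smul, map_smul]; rfl }
  have hT : ∀ M x, T M x = S (M.mulVec (S.symm x)) := fun M x => rfl
  have hTE : ∀ M, T M ∈ E := fun M => by
    rw [hE]
    intro d x
    obtain ⟨q, rfl⟩ := S.surjective x
    rw [hT, hT, hSR, S.symm_apply_apply, S.symm_apply_apply, hmul, hSR]
  let ψ : Matrix (Fin m) (Fin m) D →ₐ[ℝ] E := AlgHom.ofLinearMap
    { toFun := fun M => ⟨T M, hTE M⟩
      map_add' := fun M N => by
        ext x
        simp [hT, Matrix.add_mulVec]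
      map_smul' := fun c M => by
        ext x
        simp [hT, Matrix.smul_mulVec] }
    (by
      ext x
      simp [hT])
    (fun M N => by
      ext x
      simp [hT])
  have hψ : ∀ M q, (ψ M).1 (S q) = S (M.mulVec q) := fun M q => by
    change T M (S q) = _
    rw [hT, S.symm_apply_apply]
  have hbij : Function.Bijective ψ := by
    constructor
    · intro M N h
      refine Matrix.ext_of_mulVec_single fun i => S.injective ?_
      rw [← hψ, ← hψ, h]
    · intro x
      refine ⟨Matrix.of fun k l => S.symm (x.1 (v l)) k, ?_⟩
      ext y
      obtain ⟨q, rfl⟩ := S.surjective y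
      rw [hψ]
      have h1 : S q = ∑ l, (R (q l)).unop (v l) := rfl
      have h2 : ∀ l, x.1 ((R (q l)).unop (v l)) = S (fun k => S.symm (x.1 (v l)) k * q l) := by
        intro l
        rw [(hE x.1).1 x.2, ← hSR]
        simp
      rw [h1, map_sum]
      simp only [h2]
      rw [← map_sum]
      congr 1
      ext k
      simp [Matrix.mulVec, dotProduct]
  refine ⟨(AlgEquiv.ofBijective ψ hbij).symm, fun x q => ?_⟩
  have h := hψ ((AlgEquiv.ofBijective ψ hbij).symm x) q
  rw [← AlgEquiv.ofBijective_apply ψ hbij, AlgEquiv.apply_symm_apply] at h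
  exact h.symm

/-- The commutant of a bounded right action of `D` is quantitatively a matrix algebra. -/
theorem exists_matrix_algEquiv [FiniteDimensional ℝ V] [Nontrivial V] [FiniteDimensional ℝ D]
    (hB1 : 1 ≤ B) (hB : ∀ d v, ‖(R d).unop v‖ ≤ B * ‖d‖ * ‖v‖) {E : Subalgebra ℝ (V →L[ℝ] V)}
    (hE : ∀ x, x ∈ E ↔ ∀ d v, x ((R d).unop v) = (R d).unop (x v)) :
    ∃ m : ℕ, 0 < m ∧ finrank ℝ V = finrank ℝ D * m ∧
      ∃ φ : E ≃ₐ[ℝ] Matrix (Fin m) (Fin m) D, ∀ x : E,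
        ‖x.1‖ ≤ finrank ℝ V ^ 2 * (2 * B ^ 2) ^ (finrank ℝ V + 1) * matOpNorm (φ x) ∧
        matOpNorm (φ x) ≤ finrank ℝ V ^ 2 * (2 * B ^ 2) ^ (finrank ℝ V + 1) * ‖x.1‖ := by
  have hB0 : 0 ≤ B := by linarith
  obtain ⟨m, v, hv, hbij⟩ := exists_isQuantIndep_bijective hB0 hB
  obtain ⟨φ, hφ⟩ := exists_matrix_algEquiv_of_bijective hbij hE
  have hrank : finrank ℝ V = finrank ℝ D * m := by
    rw [← (LinearEquiv.ofBijective _ hbij).finrank_eq, Module.finrank_pi_fintype]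
    simp [mul_comm]
  have hVpos : 0 < finrank ℝ V := finrank_pos
  have hDpos : 0 < finrank ℝ D := finrank_pos
  have hm : 0 < m := Nat.pos_of_ne_zero (by rintro rfl; omega)
  have hmn : m ≤ finrank ℝ V := by rw [hrank]; exact Nat.le_mul_of_pos_left m hDpos
  refine ⟨m, hm, hrank, φ, ?_⟩
  set n := finrank ℝ V
  set a : ℝ := m * B with ha
  set b : ℝ := m * (B * (1 + B ^ 2) ^ m) with hb
  have hub : ∀ q, ‖rightCombination R v q‖ ≤ a * ‖WithLp.toLp 2 q‖ :=
    norm_rightCombination_le hv hB0 hB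
  have hlb : ∀ q, ‖WithLp.toLp 2 q‖ ≤ b * ‖rightCombination R v q‖ := fun q => by
    rw [hb, mul_assoc]
    exact norm_toLp_le_card_mul q (hv.2 q)
  have hab : a * b ≤ n ^ 2 * (2 * B ^ 2) ^ (n + 1) := by
    have h1 : (m : ℝ) ^ 2 ≤ n ^ 2 := by gcongr
    have hB2 : 1 ≤ B ^ 2 := one_le_pow₀ hB1
    have h2 : (1 + B ^ 2) ^ m ≤ (2 * B ^ 2) ^ n :=
      (pow_le_pow_left₀ (by positivity) (by linarith) m).trans
        (pow_le_pow_right₀ (by linarith) hmn)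
    calc a * b = m ^ 2 * (B ^ 2 * (1 + B ^ 2) ^ m) := by rw [ha, hb]; ring
      _ ≤ n ^ 2 * (2 * B ^ 2 * (2 * B ^ 2) ^ n) := by
        gcongr
        linarith
      _ = n ^ 2 * (2 * B ^ 2) ^ (n + 1) := by rw [pow_succ' (2 * B ^ 2) n]
  have ha0 : 0 ≤ a := by positivity
  have hb0 : 0 ≤ b := by positivity
  intro x
  have hM : ∀ q : Fin m → D,
      ‖WithLp.toLp 2 ((φ x).mulVec q)‖ ≤ a * b * ‖x.1‖ * ‖WithLp.toLp 2 q‖ := fun q => by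
    calc ‖WithLp.toLp 2 ((φ x).mulVec q)‖ ≤ b * ‖x.1 (rightCombination R v q)‖ := by
          rw [← hφ]; exact hlb _
      _ ≤ b * (‖x.1‖ * (a * ‖WithLp.toLp 2 q‖)) := by
        gcongr
        exact (x.1.le_opNorm _).trans (mul_le_mul_of_nonneg_left (hub q) (norm_nonneg _))
      _ = a * b * ‖x.1‖ * ‖WithLp.toLp 2 q‖ := by ring
  have hle := matOpNorm_le (by positivity) hM
  have hge := le_matOpNorm (by positivity) hM
  have hnn : 0 ≤ matOpNorm (φ x) := Real.sSup_nonneg (by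
    rintro _ ⟨v, -, rfl⟩
    exact norm_nonneg _)
  refine ⟨?_, hle.trans (mul_le_mul_of_nonneg_right hab (norm_nonneg _))⟩
  refine le_trans ?_ (mul_le_mul_of_nonneg_right hab hnn)
  refine x.1.opNorm_le_bound (by positivity) fun y => ?_
  obtain ⟨q, rfl⟩ := hbij.2 y
  rw [← hφ]
  calc _ ≤ a * ‖WithLp.toLp 2 ((φ x).mulVec q)‖ := hub _
    _ ≤ a * (matOpNorm (φ x) * (b * ‖rightCombination R v q‖)) := by
      gcongr
      exact (hge q).trans (mul_le_mul_of_nonneg_left (hlb q) hnn)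
    _ = a * b * matOpNorm (φ x) * ‖rightCombination R v q‖ := by ring

end RightAction

section Assembly

open MulOpposite Module

variable {n : ℕ} {ρ : ℝ}
  {E : Subalgebra ℝ (EuclideanSpace ℝ (Fin n) →L[ℝ] EuclideanSpace ℝ (Fin n))}

theorem ActsIrreducibly.norm_le_of_mul_self_eq_neg_one (hρ : 0 < ρ) (hρ1 : ρ ≤ 1)
    (hE : ActsIrreducibly ρ E) {J : EuclideanSpace ℝ (Fin n) →L[ℝ] EuclideanSpace ℝ (Fin n)}
    (hJE : ∀ a ∈ E, a * J = J * a) (hJ : J * J = -1) : ‖J‖ ≤ (ρ ^ n)⁻¹ := by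
  have hp : 0 < ρ ^ n := pow_pos hρ n
  refine J.opNorm_le_bound (by positivity) fun v => ?_
  have h1 := hE.pow_mul_norm_apply_le hρ hρ1 (T := J.toLinearMap)
    (fun a ha v => (DFunLike.congr_fun (hJE a ha) v).symm) v (J v)
  have h2 : J (J v) = -v := DFunLike.congr_fun hJ v
  simp only [ContinuousLinearMap.coe_coe, h2, norm_neg] at h1
  have h3 : (ρ ^ n) ^ 2 ≤ ρ ^ n := by
    rw [pow_two]
    exact mul_le_of_le_one_right hp.le (pow_le_one₀ hρ.le hρ1)
  rw [← div_eq_inv_mul, le_div_iff₀ hp]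
  refine le_of_sq_le_sq ?_ (norm_nonneg v)
  calc (‖J v‖ * ρ ^ n) ^ 2 = (ρ ^ n) ^ 2 * ‖J v‖ ^ 2 := by ring
    _ ≤ ρ ^ n * ‖J v‖ ^ 2 := by gcongr
    _ = ρ ^ n * (‖J v‖ * ‖J v‖) := by ring
    _ ≤ ‖v‖ ^ 2 := by rw [pow_two ‖v‖]; exact h1

/-- The multiplicative constant of the effective Wedderburn theorem. -/
noncomputable def wedderburnConst (n : ℕ) : ℝ := n ^ 2 * 32 ^ (n + 1)

theorem one_le_wedderburnConst (hn : 0 < n) : 1 ≤ wedderburnConst n := by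
  have : (1 : ℝ) ≤ n := by exact_mod_cast hn
  exact one_le_mul_of_one_le_of_one_le (one_le_pow₀ this) (one_le_pow₀ (by norm_num))

theorem ActsIrreducibly.exists_matrix_algEquiv {D : Type*} [NormedDivisionRing D]
    [NormedAlgebra ℝ D] [FiniteDimensional ℝ D] [NeZero n] (hρ : 0 < ρ) (hρ1 : ρ ≤ 1)
    (hE : ActsIrreducibly ρ E)
    {f : D →ₐ[ℝ] (Subalgebra.centralizer ℝ
      (E : Set (EuclideanSpace ℝ (Fin n) →L[ℝ] EuclideanSpace ℝ (Fin n))))ᵐᵒᵖ}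
    (hf : Function.Surjective f) (hfB : ∀ d, ‖(f d).unop.1‖ ≤ 4 * (ρ ^ n)⁻¹ * ‖d‖) :
    ∃ m : ℕ, 0 < m ∧ n = finrank ℝ D * m ∧
      ∃ φ : E ≃ₐ[ℝ] Matrix (Fin m) (Fin m) D, ∀ x : E,
        (wedderburnConst n)⁻¹ * ρ ^ ((n * (2 * n + 2) : ℕ) : ℝ) *
          ‖(x : EuclideanSpace ℝ (Fin n) →L[ℝ] EuclideanSpace ℝ (Fin n))‖ ≤ matOpNorm (φ x) ∧
        matOpNorm (φ x) ≤ wedderburnConst n * ρ ^ (-((n * (2 * n + 2) : ℕ) : ℝ)) *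
          ‖(x : EuclideanSpace ℝ (Fin n) →L[ℝ] EuclideanSpace ℝ (Fin n))‖ := by
  have hp : 0 < ρ ^ n := pow_pos hρ n
  have hB1 : 1 ≤ 4 * (ρ ^ n)⁻¹ := by
    have : 1 ≤ (ρ ^ n)⁻¹ := (one_le_inv₀ hp).2 (pow_le_one₀ hρ.le hρ1)
    linarith
  let R : D →ₐ[ℝ] (EuclideanSpace ℝ (Fin n) →L[ℝ] EuclideanSpace ℝ (Fin n))ᵐᵒᵖ :=
    (AlgHom.op (Subalgebra.val _)).comp f
  have hR : ∀ d, (R d).unop = (f d).unop.1 := fun d => rfl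
  have hmem : ∀ x, x ∈ E ↔ ∀ d v, x ((R d).unop v) = (R d).unop (x v) := by
    refine fun x => ⟨fun hx d v => ?_, fun hx => ?_⟩
    · exact DFunLike.congr_fun ((Subalgebra.mem_centralizer_iff ℝ).1 (f d).unop.2 x hx) v
    · refine mem_of_irreducible_of_commute (hE.eq_bot_or_eq_top hρ) fun T hT => ?_
      obtain ⟨d, hd⟩ := hf (op ⟨T, hT⟩)
      ext1 v
      have := hx d v
      rw [hR, hd] at this
      exact this
  obtain ⟨m, hm, hrank, φ, hφ⟩ := _root_.exists_matrix_algEquiv (R := R) hB1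
    (fun d v => ((R d).unop.le_opNorm v).trans
      (mul_le_mul_of_nonneg_right (hfB d) (norm_nonneg v))) hmem
  rw [finrank_euclideanSpace_fin] at hrank hφ
  have hK : (n : ℝ) ^ 2 * (2 * (4 * (ρ ^ n)⁻¹) ^ 2) ^ (n + 1) =
      wedderburnConst n * ρ ^ (-((n * (2 * n + 2) : ℕ) : ℝ)) := by
    rw [Real.rpow_neg hρ.le, Real.rpow_natCast, wedderburnConst, mul_assoc]
    congr 1
    rw [mul_pow 4, ← mul_assoc, mul_pow, ← pow_mul, inv_pow, ← pow_mul]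
    norm_num
    ring
  rw [hK] at hφ
  refine ⟨m, hm, hrank, φ, fun x => ⟨?_, (hφ x).2⟩⟩
  have hpos : 0 < wedderburnConst n * ρ ^ (-((n * (2 * n + 2) : ℕ) : ℝ)) :=
    mul_pos (by linarith [one_le_wedderburnConst (NeZero.pos n)]) (Real.rpow_pos_of_pos hρ _)
  have hinv : (wedderburnConst n)⁻¹ * ρ ^ ((n * (2 * n + 2) : ℕ) : ℝ) =
      (wedderburnConst n * ρ ^ (-((n * (2 * n + 2) : ℕ) : ℝ)))⁻¹ := by
    rw [mul_inv, Real.rpow_neg hρ.le, inv_inv]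
  rw [hinv, inv_mul_le_iff₀ hpos]
  exact (hφ x).1

end Assembly

theorem Quaternion.abs_components_le_norm (q : Quaternion ℝ) :
    |q.re| ≤ ‖q‖ ∧ |q.imI| ≤ ‖q‖ ∧ |q.imJ| ≤ ‖q‖ ∧ |q.imK| ≤ ‖q‖ := by
  have h : ‖q‖ ^ 2 = q.re ^ 2 + q.imI ^ 2 + q.imJ ^ 2 + q.imK ^ 2 := by
    rw [pow_two, ← Quaternion.normSq_eq_norm_mul_self, Quaternion.normSq_def']
  refine ⟨?_, ?_, ?_, ?_⟩ <;> refine abs_le_of_sq_le_sq ?_ (norm_nonneg q) <;>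
    nlinarith [sq_nonneg q.re, sq_nonneg q.imI, sq_nonneg q.imJ, sq_nonneg q.imK]

theorem Quaternion.exists_units_eq_smul_add :
    ∃ i j k : Quaternion ℝ, i * i = -1 ∧ j * j = -1 ∧ k * k = -1 ∧
      ∀ q : Quaternion ℝ, q = q.re • 1 + q.imI • i + q.imJ • j + q.imK • k := by
  have h (a b c d : ℝ) :
      ∃ q : Quaternion ℝ, q.re = a ∧ q.imI = b ∧ q.imJ = c ∧ q.imK = d :=
    ⟨⟨a, b, c, d⟩, rfl, rfl, rfl, rfl⟩
  obtain ⟨i, hi⟩ := h 0 1 0 0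
  obtain ⟨j, hj⟩ := h 0 0 1 0
  obtain ⟨k, hk⟩ := h 0 0 0 1
  refine ⟨i, j, k, ?_, ?_, ?_, fun q => ?_⟩ <;> apply Quaternion.ext <;> simp [hi, hj, hk]

/-- **Proposition 5.1** (effective Wedderburn theorem): a unital subalgebra of
`End(ℝⁿ) ≅ Mat_n(ℝ)` acting `ρ`-irreducibly on `ℝⁿ` is isomorphic to `Mat_m(D)` for some
`D ∈ {ℝ, ℂ, ℍ}` with `m · dim_ℝ D = n`, via an isomorphism which together with its inverse
is `K ρ^{-C}`-Lipschitz for the natural operator norms. -/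
theorem effective_wedderburn (n : ℕ) (hn : 0 < n) :
    ∃ K : ℝ, 1 ≤ K ∧ ∃ C : ℝ, 1 ≤ C ∧
      ∀ ρ : ℝ, 0 < ρ → ρ ≤ 1 / 2 →
        ∀ E : Subalgebra ℝ (EuclideanSpace ℝ (Fin n) →L[ℝ] EuclideanSpace ℝ (Fin n)),
          (∀ W : Submodule ℝ (EuclideanSpace ℝ (Fin n)), W ≠ ⊥ → W ≠ ⊤ →
            ∃ a ∈ E, ‖a‖ ≤ 1 ∧ ∃ w ∈ W, ‖w‖ ≤ 1 ∧
              ρ ≤ Metric.infDist (a w) (W : Set (EuclideanSpace ℝ (Fin n)))) →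
          ((∃ φ : E ≃ₐ[ℝ] Matrix (Fin n) (Fin n) ℝ,
              ∀ x : E,
                K⁻¹ * ρ ^ C * ‖(x : EuclideanSpace ℝ (Fin n) →L[ℝ] EuclideanSpace ℝ (Fin n))‖
                    ≤ matOpNorm (φ x) ∧
                  matOpNorm (φ x) ≤ K * ρ ^ (-C) *
                    ‖(x : EuclideanSpace ℝ (Fin n) →L[ℝ] EuclideanSpace ℝ (Fin n))‖) ∨
            (∃ m : ℕ, 0 < m ∧ n = 2 * m ∧
              ∃ φ : E ≃ₐ[ℝ] Matrix (Fin m) (Fin m) ℂ,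
                ∀ x : E,
                  K⁻¹ * ρ ^ C * ‖(x : EuclideanSpace ℝ (Fin n) →L[ℝ] EuclideanSpace ℝ (Fin n))‖
                      ≤ matOpNorm (φ x) ∧
                    matOpNorm (φ x) ≤ K * ρ ^ (-C) *
                      ‖(x : EuclideanSpace ℝ (Fin n) →L[ℝ] EuclideanSpace ℝ (Fin n))‖) ∨
            (∃ m : ℕ, 0 < m ∧ n = 4 * m ∧
              ∃ φ : E ≃ₐ[ℝ] Matrix (Fin m) (Fin m) (Quaternion ℝ),
                ∀ x : E,
                  K⁻¹ * ρ ^ C * ‖(x : EuclideanSpace ℝ (Fin n) →L[ℝ] EuclideanSpace ℝ (Fin n))‖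
                      ≤ matOpNorm (φ x) ∧
                    matOpNorm (φ x) ≤ K * ρ ^ (-C) *
                      ‖(x : EuclideanSpace ℝ (Fin n) →L[ℝ] EuclideanSpace ℝ (Fin n))‖)) := by
  have : NeZero n := ⟨hn.ne'⟩
  refine ⟨wedderburnConst n, one_le_wedderburnConst hn, ((n * (2 * n + 2) : ℕ) : ℝ), ?_, ?_⟩
  · exact_mod_cast Nat.mul_pos hn (by omega)
  intro ρ hρ hρ2 E hE
  have hρ1 : ρ ≤ 1 := by linarith
  replace hE : ActsIrreducibly ρ E := hE
  have hdom := isDomain_centralizer_of_irreducible (hE.eq_bot_or_eq_top hρ)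
  set A := Subalgebra.centralizer ℝ
    (E : Set (EuclideanSpace ℝ (Fin n) →L[ℝ] EuclideanSpace ℝ (Fin n))) with hA
  have : FiniteDimensional ℝ Aᵐᵒᵖ := Module.Finite.equiv (MulOpposite.opLinearEquiv ℝ (M := A))
  have hM1 : 1 ≤ (ρ ^ n)⁻¹ := (one_le_inv₀ (pow_pos hρ n)).2 (pow_le_one₀ hρ.le hρ1)
  have hunit : ∀ J : Aᵐᵒᵖ, J * J = -1 → ‖J.unop.1‖ ≤ (ρ ^ n)⁻¹ := fun J hJ =>
    hE.norm_le_of_mul_self_eq_neg_one hρ hρ1 ((Subalgebra.mem_centralizer_iff ℝ).1 J.unop.2)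
      (congrArg (fun T : Aᵐᵒᵖ => T.unop.1) hJ)
  have hone : ‖(1 : Aᵐᵒᵖ).unop.1‖ ≤ (ρ ^ n)⁻¹ :=
    ContinuousLinearMap.norm_id_le.trans hM1
  have hsmul : ∀ (r c : ℝ) (J : Aᵐᵒᵖ), |r| ≤ c → ‖J.unop.1‖ ≤ (ρ ^ n)⁻¹ →
      ‖(r • J).unop.1‖ ≤ (ρ ^ n)⁻¹ * c := fun r c J hr hJ => by
    have : (r • J).unop.1 = r • J.unop.1 := rfl
    rw [this, norm_smul, mul_comm, Real.norm_eq_abs]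
    exact mul_le_mul hJ hr (abs_nonneg r) (by positivity)
  have hadd : ∀ (J K : Aᵐᵒᵖ), ‖(J + K).unop.1‖ ≤ ‖J.unop.1‖ + ‖K.unop.1‖ :=
    fun J K => norm_add_le J.unop.1 K.unop.1
  rcases frobenius_surjective (A := Aᵐᵒᵖ) with hf | ⟨f, hf⟩ | ⟨f, hf⟩
  · left
    obtain ⟨m, -, hnm, h⟩ := hE.exists_matrix_algEquiv hρ hρ1 (f := Algebra.ofId ℝ Aᵐᵒᵖ) hf
      (fun r => by
        have h1 : Algebra.ofId ℝ Aᵐᵒᵖ r = r • 1 := Algebra.algebraMap_eq_smul_one r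
        have h2 := hsmul r ‖r‖ 1 le_rfl hone
        rw [h1]
        nlinarith [norm_nonneg r])
    rw [Module.finrank_self, one_mul] at hnm
    subst hnm
    exact h
  · right; left
    obtain ⟨m, hm, hnm, h⟩ := hE.exists_matrix_algEquiv hρ hρ1 (f := f) hf (fun z => by
      have h1 : f z = z.re • 1 + z.im • f Complex.I := by
        rw [← map_one f, ← map_smul, ← map_smul, ← map_add]
        congr 1
        apply Complex.ext <;> simp
      have h2 := hsmul _ _ _ z.abs_re_le_norm hone
      have h3 := hsmul _ _ _ z.abs_im_le_norm (hunit (f Complex.I) (by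
        rw [← map_mul, Complex.I_mul_I, map_neg, map_one]))
      rw [h1]
      have := hadd (z.re • 1) (z.im • f Complex.I)
      nlinarith [norm_nonneg z])
    rw [Complex.finrank_real_complex] at hnm
    exact ⟨m, hm, hnm, h⟩
  · right; right
    obtain ⟨i, j, k, hi, hj, hk, hq⟩ := Quaternion.exists_units_eq_smul_add
    obtain ⟨m, hm, hnm, h⟩ := hE.exists_matrix_algEquiv hρ hρ1 (f := f) hf (fun q => by
      have hsq : ∀ u : Quaternion ℝ, u * u = -1 → ‖(f u).unop.1‖ ≤ (ρ ^ n)⁻¹ := fun u hu =>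
        hunit _ (by rw [← map_mul, hu, map_neg, map_one])
      have h1 : f q = q.re • 1 + q.imI • f i + q.imJ • f j + q.imK • f k := by
        rw [← map_one f, ← map_smul, ← map_smul, ← map_smul, ← map_smul, ← map_add, ← map_add,
          ← map_add]
        exact congrArg f (hq q)
      obtain ⟨a0, a1, a2, a3⟩ := q.abs_components_le_norm
      have h2 := hsmul _ _ _ a0 hone
      have h3 := hsmul _ _ _ a1 (hsq i hi)
      have h4 := hsmul _ _ _ a2 (hsq j hj)
      have h5 := hsmul _ _ _ a3 (hsq k hk)
      rw [h1]
      refine (hadd _ _).trans ?_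
      refine (add_le_add_left (hadd _ _) _).trans ?_
      refine (add_le_add_left (add_le_add_left (hadd _ _) _) _).trans ?_
      linarith)
    rw [Quaternion.finrank_eq_four] at hnm
    exact ⟨m, hm, hnm, h⟩
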